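/- arXiv:2603.01521 — 3 statements merged into one kernel-verified Lean document; each statement's English description precedes it below -/
import Mathlib

section
/- Fix n, d ∈ ℕ with d ≥ 1, γ ∈ ℝ, and unitary 2ⁿ×2ⁿ complex matrices C₁, …, C_d. Let N be the n-qubit depolarizing channel N(ρ) = ∑_{q : Fin n → Fin 4} (∏_i w(q i)) P_q ρ P_q with w(0) = 1 − 3γ/4 and w(j) = γ/4 for j ≠ 0, and let ρ₀ = |0ⁿ⟩⟨0ⁿ| be the rank-one projection onto the vector e₀ that is 1 at the all-zero index and 0 elsewhere. Then the output state ρ = (N ∘ Ad_{C_d} ∘ ⋯ ∘ N ∘ Ad_{C₁})(ρ₀), where Ad_C(ρ) = CρC†, admits the Pauli path expansion ρ = ∑_{s₀, s₁, …, s_d : Fin n → Fin 4} (1 − γ)^{∑_{k=1}^{d} |s_k|} · (∏_{k=1}^{d} 2^{−n} Tr(P_{s_k} C_k P_{s_{k−1}} C_k†)) · 2^{−n} ⟨0ⁿ|P_{s₀}|0ⁿ⟩ · P_{s_d}, where ⟨0ⁿ|P_{s₀}|0ⁿ⟩ is the (all-zero, all-zero) entry of P_{s₀}. -/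
open Matrix

namespace Stmt3

/-- The four single-qubit Pauli matrices σ₀ = I, σ₁ = X, σ₂ = Y, σ₃ = Z. -/
noncomputable def σ : Fin 4 → Matrix (Fin 2) (Fin 2) ℂ :=
  ![!![1, 0; 0, 1], !![0, 1; 1, 0], !![0, -Complex.I; Complex.I, 0], !![1, 0; 0, -1]]

/-- The n-qubit Pauli string `P_p`, the Kronecker product of the `σ (p i)`. -/
noncomputable def PString (n : ℕ) (p : Fin n → Fin 4) :
    Matrix (Fin n → Fin 2) (Fin n → Fin 2) ℂ :=
  Matrix.of fun x y => ∏ i, σ (p i) (x i) (y i)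

/-- The Pauli weight `|p|`: the number of non-identity tensor factors. -/
def weight {n : ℕ} (p : Fin n → Fin 4) : ℕ :=
  (Finset.univ.filter fun i => p i ≠ 0).card

/-- The n-qubit depolarizing channel with per-qubit Pauli weights `w`. -/
noncomputable def depo (n : ℕ) (w : Fin 4 → ℝ)
    (ρ : Matrix (Fin n → Fin 2) (Fin n → Fin 2) ℂ) :
    Matrix (Fin n → Fin 2) (Fin n → Fin 2) ℂ :=
  ∑ q : Fin n → Fin 4, ((∏ i, w (q i) : ℝ) : ℂ) • (PString n q * ρ * PString n q)

/-- The all-zero basis index `0ⁿ`. -/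
def zeros (n : ℕ) : Fin n → Fin 2 := fun _ => 0

/-- The initial state `ρ₀ = |0ⁿ⟩⟨0ⁿ|`. -/
noncomputable def rho0 (n : ℕ) : Matrix (Fin n → Fin 2) (Fin n → Fin 2) ℂ :=
  Matrix.of fun x y => if x = zeros n ∧ y = zeros n then 1 else 0

/-- Single-qubit completeness of the Pauli matrices. -/
lemma sum_σ_mul_σ (a b x y : Fin 2) :
    ∑ j, σ j a b * σ j x y = if a = y ∧ b = x then 2 else 0 := by
  fin_cases a <;> fin_cases b <;> fin_cases x <;> fin_cases y <;>
    simp [σ, Fin.sum_univ_four] <;> norm_num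

lemma sum_PString_mul_PString (n : ℕ) (a b x y : Fin n → Fin 2) :
    ∑ p, PString n p a b * PString n p x y = if a = y ∧ b = x then (2 : ℂ) ^ n else 0 := by
  simp only [PString, Matrix.of_apply, ← Finset.prod_mul_distrib]
  rw [← Fintype.prod_sum fun i j => σ j (a i) (b i) * σ j (x i) (y i)]
  simp only [sum_σ_mul_σ]
  split_ifs with h
  · simp [h.1, h.2]
  · obtain ⟨i, hi⟩ : ∃ i, ¬(a i = y i ∧ b i = x i) := by
      by_contra! h'
      exact h ⟨funext fun i => (h' i).1, funext fun i => (h' i).2⟩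
    exact Finset.prod_eq_zero (Finset.mem_univ i) (if_neg hi)

/-- Every matrix is the combination of Pauli strings with its normalized Pauli coefficients. -/
lemma eq_sum_trace_smul_PString (n : ℕ) (M : Matrix (Fin n → Fin 2) (Fin n → Fin 2) ℂ) :
    M = ∑ p, (((2 : ℂ) ^ n)⁻¹ * Matrix.trace (PString n p * M)) • PString n p := by
  ext x y
  have key : ∑ p, Matrix.trace (PString n p * M) * PString n p x y = 2 ^ n * M x y := by
    simp only [Matrix.trace, Matrix.diag_apply, Matrix.mul_apply, Finset.sum_mul]
    rw [Finset.sum_comm]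
    simp_rw [Finset.sum_comm (s := (Finset.univ : Finset (Fin n → Fin 4))),
      mul_right_comm _ (M _ _), ← Finset.sum_mul, sum_PString_mul_PString, ite_and, ite_mul,
      zero_mul]
    simp
  simp only [Matrix.sum_apply, Matrix.smul_apply, smul_eq_mul, mul_assoc, ← Finset.mul_sum, key]
  rw [inv_mul_cancel_left₀ (by simp)]

/-- The product of two Kronecker products is computed factorwise. -/
lemma of_prod_mul_of_prod {n : ℕ} (A B : Fin n → Matrix (Fin 2) (Fin 2) ℂ) :
    (Matrix.of fun x y : Fin n → Fin 2 => ∏ i, A i (x i) (y i)) *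
        (Matrix.of fun x y : Fin n → Fin 2 => ∏ i, B i (x i) (y i)) =
      Matrix.of fun x y : Fin n → Fin 2 => ∏ i, (A i * B i) (x i) (y i) := by
  ext x y
  simp only [Matrix.mul_apply, Matrix.of_apply, ← Finset.prod_mul_distrib]
  rw [← Fintype.prod_sum fun i j => A i (x i) j * B i j (y i)]

/-- Single-qubit depolarizing noise damps the non-identity Pauli matrices by `1 - γ`. -/
lemma sum_smul_σ_mul_σ_mul_σ {γ : ℝ} {w : Fin 4 → ℝ} (hw0 : w 0 = 1 - 3 * γ / 4)
    (hwj : ∀ j : Fin 4, j ≠ 0 → w j = γ / 4) (a : Fin 4) (x y : Fin 2) :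
    ∑ j, (w j : ℂ) * (σ j * σ a * σ j) x y = (if a ≠ 0 then 1 - (γ : ℂ) else 1) * σ a x y := by
  simp only [Fin.sum_univ_four, hw0, hwj 1 (by decide), hwj 2 (by decide), hwj 3 (by decide)]
  fin_cases a <;> fin_cases x <;> fin_cases y <;>
    simp [σ, Matrix.mul_apply, Fin.sum_univ_two] <;> ring

/-- Pauli strings are eigenvectors of the depolarizing channel. -/
lemma depo_PString (n : ℕ) {γ : ℝ} {w : Fin 4 → ℝ} (hw0 : w 0 = 1 - 3 * γ / 4)
    (hwj : ∀ j : Fin 4, j ≠ 0 → w j = γ / 4) (p : Fin n → Fin 4) :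
    depo n w (PString n p) = (1 - (γ : ℂ)) ^ weight p • PString n p := by
  ext x y
  simp only [depo, PString, of_prod_mul_of_prod, Matrix.sum_apply, Matrix.smul_apply,
    Matrix.of_apply, smul_eq_mul, Complex.ofReal_prod, ← Finset.prod_mul_distrib]
  rw [← Fintype.prod_sum fun i j => (w j : ℂ) * (σ j * σ (p i) * σ j) (x i) (y i)]
  simp only [sum_smul_σ_mul_σ_mul_σ hw0 hwj, Finset.prod_mul_distrib, weight,
    Finset.prod_ite, Finset.prod_const, one_pow, mul_one]

lemma depo_sum_smul {ι : Type*} [Fintype ι] (n : ℕ) (w : Fin 4 → ℝ) (c : ι → ℂ)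
    (M : ι → Matrix (Fin n → Fin 2) (Fin n → Fin 2) ℂ) :
    depo n w (∑ i, c i • M i) = ∑ i, c i • depo n w (M i) := by
  simp only [depo, Finset.mul_sum, Finset.sum_mul, Finset.smul_sum, Matrix.mul_smul,
    Matrix.smul_mul]
  rw [Finset.sum_comm]
  exact Finset.sum_congr rfl fun i _ => Finset.sum_congr rfl fun q _ => smul_comm _ _ _

/-- One noisy layer, expanded in the Pauli basis. -/
lemma depo_eq_sum (n : ℕ) {γ : ℝ} {w : Fin 4 → ℝ} (hw0 : w 0 = 1 - 3 * γ / 4)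
    (hwj : ∀ j : Fin 4, j ≠ 0 → w j = γ / 4) (M : Matrix (Fin n → Fin 2) (Fin n → Fin 2) ℂ) :
    depo n w M = ∑ p, (((2 : ℂ) ^ n)⁻¹ * Matrix.trace (PString n p * M) *
      (1 - (γ : ℂ)) ^ weight p) • PString n p := by
  conv_lhs => rw [eq_sum_trace_smul_PString n M, depo_sum_smul]
  simp only [depo_PString n hw0 hwj, smul_smul]

lemma trace_PString_mul_rho0 (n : ℕ) (p : Fin n → Fin 4) :
    Matrix.trace (PString n p * rho0 n) = PString n p (zeros n) (zeros n) := by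
  simp [Matrix.trace, Matrix.mul_apply, rho0, ite_and]

/-- Pauli path expansion of the output state of a depth-`d` noisy circuit,
alternating unitary layers with `n`-qubit depolarizing noise of strength `γ`. -/
theorem pauli_path_expansion (n d : ℕ) (hd : 1 ≤ d) (γ : ℝ)
    (C : Fin d → Matrix (Fin n → Fin 2) (Fin n → Fin 2) ℂ)
    (hC : ∀ k, C k ∈ Matrix.unitaryGroup (Fin n → Fin 2) ℂ)
    (w : Fin 4 → ℝ) (hw0 : w 0 = 1 - 3 * γ / 4) (hwj : ∀ j : Fin 4, j ≠ 0 → w j = γ / 4) :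
    (List.ofFn C).foldl (fun ρ Ck => depo n w (Ck * ρ * Ckᴴ)) (rho0 n)
      = ∑ s : Fin (d + 1) → (Fin n → Fin 4),
          ((((1 - γ) ^ (∑ k : Fin d, weight (s k.succ)) : ℝ) : ℂ)
            * (∏ k : Fin d, ((2 : ℂ) ^ n)⁻¹
                * Matrix.trace (PString n (s k.succ) * C k * PString n (s k.castSucc) * (C k)ᴴ))
            * (((2 : ℂ) ^ n)⁻¹ * PString n (s 0) (zeros n) (zeros n)))
          • PString n (s (Fin.last d)) := by
  clear hd hC
  induction d with
  | zero =>
    rw [← (Equiv.funUnique (Fin 1) (Fin n → Fin 4)).symm.sum_comp]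
    simp only [List.ofFn_zero, List.foldl_nil]
    conv_lhs => rw [eq_sum_trace_smul_PString n (rho0 n)]
    simp [trace_PString_mul_rho0]
  | succ d ih =>
    rw [List.ofFn_succ', List.concat_eq_append, List.foldl_append, ih, List.foldl_cons,
      List.foldl_nil, ← (Fin.snocEquiv fun _ : Fin (d + 2) => Fin n → Fin 4).sum_comp,
      Fintype.sum_prod_type, Finset.sum_comm]
    simp only [Finset.mul_sum, Finset.sum_mul, Matrix.mul_smul, Matrix.smul_mul, depo_sum_smul]
    refine Finset.sum_congr rfl fun s _ => ?_
    rw [depo_eq_sum n hw0 hwj, Finset.smul_sum]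
    refine Finset.sum_congr rfl fun p _ => ?_
    rw [smul_smul]
    have h0 : (Fin.snoc s p : Fin (d + 2) → Fin n → Fin 4) 0 = s 0 :=
      Fin.snoc_castSucc (α := fun _ => Fin n → Fin 4) p s 0
    simp only [Fin.snocEquiv, Equiv.coe_fn_mk, Fin.sum_univ_castSucc, Fin.prod_univ_castSucc,
      Fin.succ_castSucc, Fin.snoc_castSucc, Fin.succ_last, Fin.snoc_last, h0, pow_add]
    push_cast
    simp only [Matrix.mul_assoc]
    congr 1
    ring

end Stmt3
end

section
/- Fix n ∈ ℕ. For f : Fin n → Fin 6 let ψ_f be the product stabilizer state in ℂ^{2ⁿ} defined componentwise by ψ_f(x) = ∏_i (s_{f i})(x i) for x : Fin n → Fin 2, where s₀, …, s₅ are the six single-qubit stabilizer states. Then for all p, q : Fin n → Fin 4, 6^{−n} ∑_{f : Fin n → Fin 6} ⟨ψ_f|P_p|ψ_f⟩ · ⟨ψ_f|P_q|ψ_f⟩ = 3^{−|p|} if p = q, and 0 if p ≠ q, where ⟨ψ|A|ψ⟩ denotes the quadratic form (star ψ)ᵀ A ψ. -/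
open Matrix

namespace Stmt13

/-- The four single-qubit Pauli matrices σ₀ = I, σ₁ = X, σ₂ = Y, σ₃ = Z. -/
noncomputable def σ : Fin 4 → Matrix (Fin 2) (Fin 2) ℂ :=
  ![!![1, 0; 0, 1], !![0, 1; 1, 0], !![0, -Complex.I; Complex.I, 0], !![1, 0; 0, -1]]

/-- The n-qubit Pauli string `P_p`, the Kronecker product of the `σ (p i)`. -/
noncomputable def PString (n : ℕ) (p : Fin n → Fin 4) :
    Matrix (Fin n → Fin 2) (Fin n → Fin 2) ℂ :=
  Matrix.of fun x y => ∏ i, σ (p i) (x i) (y i)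

/-- The Pauli weight `|p|`: the number of non-identity tensor factors. -/
def weight {n : ℕ} (p : Fin n → Fin 4) : ℕ :=
  (Finset.univ.filter fun i => p i ≠ 0).card

/-- The six single-qubit stabilizer states
`|0⟩, |1⟩, |+⟩, |−⟩, |y+⟩, |y−⟩` as unit vectors in ℂ². -/
noncomputable def stab : Fin 6 → (Fin 2 → ℂ) :=
  ![![1, 0],
    ![0, 1],
    ![((Real.sqrt 2 : ℝ) : ℂ)⁻¹, ((Real.sqrt 2 : ℝ) : ℂ)⁻¹],
    ![((Real.sqrt 2 : ℝ) : ℂ)⁻¹, -((Real.sqrt 2 : ℝ) : ℂ)⁻¹],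
    ![((Real.sqrt 2 : ℝ) : ℂ)⁻¹, Complex.I * ((Real.sqrt 2 : ℝ) : ℂ)⁻¹],
    ![((Real.sqrt 2 : ℝ) : ℂ)⁻¹, -(Complex.I * ((Real.sqrt 2 : ℝ) : ℂ)⁻¹)]]

/-- The product stabilizer state `ψ_f ∈ ℂ^{2ⁿ}` determined by `f : Fin n → Fin 6`. -/
noncomputable def ψ (n : ℕ) (f : Fin n → Fin 6) : (Fin n → Fin 2) → ℂ :=
  fun x => ∏ i, stab (f i) (x i)

/-- The quadratic form `⟨v|A|v⟩ = (star v)ᵀ A v`. -/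
noncomputable def expVal (n : ℕ) (v : (Fin n → Fin 2) → ℂ)
    (A : Matrix (Fin n → Fin 2) (Fin n → Fin 2) ℂ) : ℂ :=
  star v ⬝ᵥ A.mulVec v

/-- The single-qubit expectation values `⟨s_k|σ_a|s_k⟩`, with rows indexed by `a` and columns
by `k`. -/
def stabExpVal : Fin 4 → Fin 6 → ℂ :=
  ![![1, 1, 1, 1, 1, 1],
    ![0, 0, 1, -1, 0, 0],
    ![0, 0, 0, 0, 1, -1],
    ![1, -1, 0, 0, 0, 0]]

theorem star_stab_dotProduct_σ_mulVec (a : Fin 4) (k : Fin 6) :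
    star (stab k) ⬝ᵥ σ a *ᵥ stab k = stabExpVal a k := by
  have hsq : ((Real.sqrt 2 : ℝ) : ℂ)⁻¹ * ((Real.sqrt 2 : ℝ) : ℂ)⁻¹ = 1 / 2 := by
    rw [← mul_inv, ← Complex.ofReal_mul, Real.mul_self_sqrt zero_le_two]
    norm_num
  have hI := Complex.I_mul_I
  fin_cases a <;> fin_cases k <;>
    simp [stab, σ, stabExpVal, dotProduct, mulVec, Fin.sum_univ_two] <;> grind

/-- The single-qubit case, without the normalization by `6`. -/
theorem sum_stabExpVal_mul (a b : Fin 4) :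
    ∑ k, stabExpVal a k * stabExpVal b k =
      if a = b then 6 * (if a ≠ 0 then (3 : ℂ)⁻¹ else 1) else 0 := by
  fin_cases a <;> fin_cases b <;> simp [stabExpVal, Fin.sum_univ_six] <;> norm_num

/-- Expectation values of Pauli strings in product states factorize. -/
theorem expVal_ψ_PString (n : ℕ) (f : Fin n → Fin 6) (p : Fin n → Fin 4) :
    expVal n (ψ n f) (PString n p) = ∏ i, stabExpVal (p i) (f i) := by
  simp only [← star_stab_dotProduct_σ_mulVec, expVal, dotProduct, mulVec, Finset.mul_sum,
    Fintype.prod_sum, Finset.prod_mul_distrib, Pi.star_apply, ψ, PString, star_prod,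
    Matrix.of_apply]

/-- Second-moment identity for the uniform ensemble of product stabilizer
states: `6^{-n} ∑_f ⟨ψ_f|P_p|ψ_f⟩⟨ψ_f|P_q|ψ_f⟩ = 3^{-|p|}` if `p = q` and `0`
otherwise. -/
theorem product_stabilizer_second_moment (n : ℕ) (p q : Fin n → Fin 4) :
    ((6 : ℂ) ^ n)⁻¹ * ∑ f : Fin n → Fin 6,
        expVal n (ψ n f) (PString n p) * expVal n (ψ n f) (PString n q)
      = if p = q then ((3 : ℂ) ^ weight p)⁻¹ else 0 := by
  simp_rw [expVal_ψ_PString, ← Finset.prod_mul_distrib]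
  rw [← Fintype.prod_sum fun i k => stabExpVal (p i) k * stabExpVal (q i) k]
  simp_rw [sum_stabExpVal_mul]
  split_ifs with h
  · subst h
    simp only [if_true]
    rw [Finset.prod_mul_distrib, Finset.prod_ite]
    simp [weight]
  · obtain ⟨i, hi⟩ := Function.ne_iff.mp h
    rw [Finset.prod_eq_zero (Finset.mem_univ i) (if_neg hi), mul_zero]

end Stmt13
end

section
/- Fix n ∈ ℕ and let A = ∑_{q : Fin n → Fin 4} α_q P_q be any 2ⁿ×2ⁿ complex matrix written in the Pauli-string basis with coefficients α_q ∈ ℂ. Then for every p : Fin n → Fin 4, the randomized-measurement estimator formula holds exactly: 3^{|p|} · 6^{−n} ∑_{f : Fin n → Fin 6} ⟨ψ_f|A|ψ_f⟩ · ⟨ψ_f|P_p|ψ_f⟩ = α_p, where ψ_f is the product stabilizer state determined by f and ⟨ψ|A|ψ⟩ = (star ψ)ᵀ A ψ. -/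
open Matrix

namespace Stmt14

/-- The four single-qubit Pauli matrices σ₀ = I, σ₁ = X, σ₂ = Y, σ₃ = Z. -/
noncomputable def σ : Fin 4 → Matrix (Fin 2) (Fin 2) ℂ :=
  ![!![1, 0; 0, 1], !![0, 1; 1, 0], !![0, -Complex.I; Complex.I, 0], !![1, 0; 0, -1]]

/-- The n-qubit Pauli string `P_p`, the Kronecker product of the `σ (p i)`. -/
noncomputable def PString (n : ℕ) (p : Fin n → Fin 4) :
    Matrix (Fin n → Fin 2) (Fin n → Fin 2) ℂ :=
  Matrix.of fun x y => ∏ i, σ (p i) (x i) (y i)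

/-- The Pauli weight `|p|`: the number of non-identity tensor factors. -/
def weight {n : ℕ} (p : Fin n → Fin 4) : ℕ :=
  (Finset.univ.filter fun i => p i ≠ 0).card

/-- The six single-qubit stabilizer states
`|0⟩, |1⟩, |+⟩, |−⟩, |y+⟩, |y−⟩` as unit vectors in ℂ². -/
noncomputable def stab : Fin 6 → (Fin 2 → ℂ) :=
  ![![1, 0],
    ![0, 1],
    ![((Real.sqrt 2 : ℝ) : ℂ)⁻¹, ((Real.sqrt 2 : ℝ) : ℂ)⁻¹],
    ![((Real.sqrt 2 : ℝ) : ℂ)⁻¹, -((Real.sqrt 2 : ℝ) : ℂ)⁻¹],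
    ![((Real.sqrt 2 : ℝ) : ℂ)⁻¹, Complex.I * ((Real.sqrt 2 : ℝ) : ℂ)⁻¹],
    ![((Real.sqrt 2 : ℝ) : ℂ)⁻¹, -(Complex.I * ((Real.sqrt 2 : ℝ) : ℂ)⁻¹)]]

/-- The product stabilizer state `ψ_f ∈ ℂ^{2ⁿ}` determined by `f : Fin n → Fin 6`. -/
noncomputable def ψ (n : ℕ) (f : Fin n → Fin 6) : (Fin n → Fin 2) → ℂ :=
  fun x => ∏ i, stab (f i) (x i)

/-- The quadratic form `⟨v|A|v⟩ = (star v)ᵀ A v`. -/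
noncomputable def expVal (n : ℕ) (v : (Fin n → Fin 2) → ℂ)
    (A : Matrix (Fin n → Fin 2) (Fin n → Fin 2) ℂ) : ℂ :=
  star v ⬝ᵥ A.mulVec v

/-- The quadratic form `⟨v|M|v⟩` for a single qubit. -/
noncomputable def qubitExpVal (v : Fin 2 → ℂ) (M : Matrix (Fin 2) (Fin 2) ℂ) : ℂ :=
  ∑ a, ∑ b, star (v a) * M a b * v b

/-- The expectation of a Pauli string in a product stabilizer state factorizes over the qubits. -/
lemma expVal_ψ_PString (n : ℕ) (f : Fin n → Fin 6) (p : Fin n → Fin 4) :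
    expVal n (ψ n f) (PString n p) = ∏ i, qubitExpVal (stab (f i)) (σ (p i)) := by
  simp only [qubitExpVal, Fintype.prod_sum, expVal, dotProduct, Matrix.mulVec, PString, ψ,
    Matrix.of_apply, Pi.star_apply, star_prod, Finset.mul_sum, ← Finset.prod_mul_distrib, mul_assoc]

/-- The expectation values of the Pauli matrices in the six stabilizer states. -/
lemma qubitExpVal_stab_σ (f : Fin 6) (p : Fin 4) :
    qubitExpVal (stab f) (σ p) =
      (![![1, 0, 0, 1], ![1, 0, 0, -1], ![1, 1, 0, 0], ![1, -1, 0, 0], ![1, 0, 1, 0],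
        ![1, 0, -1, 0]] : Fin 6 → Fin 4 → ℂ) f p := by
  have h : ((Real.sqrt 2 : ℝ) : ℂ)⁻¹ * ((Real.sqrt 2 : ℝ) : ℂ)⁻¹ = 1 / 2 := by
    rw [← mul_inv, ← Complex.ofReal_mul, Real.mul_self_sqrt (by norm_num)]
    norm_num
  have hI := Complex.I_mul_I
  generalize hs : ((Real.sqrt 2 : ℝ) : ℂ)⁻¹ = s at h
  have hc : (starRingEnd ℂ) s = s := by rw [← hs]; simp
  fin_cases f <;> fin_cases p <;>
    simp [qubitExpVal, stab, σ, Fin.sum_univ_two, hs, hc] <;> grind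

/-- The Pauli matrices are orthogonal with respect to averaging over the stabilizer states. -/
lemma average_qubitExpVal_mul (q p : Fin 4) :
    (if p ≠ 0 then (3 : ℂ) else 1) * 6⁻¹ *
        ∑ f, qubitExpVal (stab f) (σ q) * qubitExpVal (stab f) (σ p) =
      if q = p then 1 else 0 := by
  simp only [qubitExpVal_stab_σ, Fin.sum_univ_six]
  fin_cases q <;> fin_cases p <;> simp <;> norm_num

/-- Averaging over product stabilizer states separates the Pauli strings. -/
lemma average_expVal_mul (n : ℕ) (q p : Fin n → Fin 4) :
    (3 : ℂ) ^ weight p * ((6 : ℂ) ^ n)⁻¹ * ∑ f : Fin n → Fin 6,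
        expVal n (ψ n f) (PString n q) * expVal n (ψ n f) (PString n p) =
      if q = p then 1 else 0 := by
  have h3 : (3 : ℂ) ^ weight p = ∏ i, if p i ≠ 0 then (3 : ℂ) else 1 := by
    rw [Finset.prod_ite, Finset.prod_const, Finset.prod_const_one, mul_one, weight]
  have h6 : ((6 : ℂ) ^ n)⁻¹ = ∏ _i : Fin n, (6 : ℂ)⁻¹ := by simp
  simp only [expVal_ψ_PString, ← Finset.prod_mul_distrib]
  rw [h3, h6, ← Fintype.prod_sum fun i f =>
    qubitExpVal (stab f) (σ (q i)) * qubitExpVal (stab f) (σ (p i)),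
    ← Finset.prod_mul_distrib, ← Finset.prod_mul_distrib]
  simp only [average_qubitExpVal_mul, Finset.prod_ite_zero, Finset.prod_const_one, funext_iff,
    Finset.mem_univ, true_implies]

/-- The quadratic form is linear in the matrix. -/
lemma expVal_sum_smul {ι : Type*} (s : Finset ι) (n : ℕ) (v : (Fin n → Fin 2) → ℂ)
    (α : ι → ℂ) (B : ι → Matrix (Fin n → Fin 2) (Fin n → Fin 2) ℂ) :
    expVal n v (∑ q ∈ s, α q • B q) = ∑ q ∈ s, α q * expVal n v (B q) := by
  simp only [expVal, Matrix.sum_mulVec, dotProduct_sum, Matrix.smul_mulVec, dotProduct_smul,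
    smul_eq_mul]

/-- The randomized-measurement estimator recovers the Pauli coefficients
exactly: if `A = ∑_q α_q P_q`, then for every Pauli string `p`,
`3^{|p|} · 6^{-n} ∑_f ⟨ψ_f|A|ψ_f⟩⟨ψ_f|P_p|ψ_f⟩ = α_p`. -/
theorem randomized_measurement_estimator (n : ℕ)
    (α : (Fin n → Fin 4) → ℂ)
    (A : Matrix (Fin n → Fin 2) (Fin n → Fin 2) ℂ)
    (hA : A = ∑ q : Fin n → Fin 4, α q • PString n q)
    (p : Fin n → Fin 4) :
    (3 : ℂ) ^ weight p * ((6 : ℂ) ^ n)⁻¹ * ∑ f : Fin n → Fin 6,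
        expVal n (ψ n f) A * expVal n (ψ n f) (PString n p)
      = α p := by
  subst hA
  simp only [expVal_sum_smul, Finset.sum_mul]
  rw [Finset.sum_comm]
  calc _ = ∑ q, α q * ((3 : ℂ) ^ weight p * ((6 : ℂ) ^ n)⁻¹ * ∑ f : Fin n → Fin 6,
        expVal n (ψ n f) (PString n q) * expVal n (ψ n f) (PString n p)) := by
        simp only [Finset.mul_sum]
        refine Finset.sum_congr rfl fun q _ => Finset.sum_congr rfl fun f _ => ?_
        ring
    _ = α p := by simp [average_expVal_mul]

end Stmt14
end
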